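/- For every integer n ≥ 2 there exist a homogeneous ideal I ⊆ ℝ[x₀,…,x_n] defining an irreducible nondegenerate projective variety of dimension 1 (a curve) with a smooth real point, a nonzero point p ∈ ℝ^{n+1}, and a Euclidean-open neighborhood U ⊆ ℝ^{n+1} of p such that every q ∈ U has real rank exactly n + 1 with respect to V_ℝ(I) (so the maximal possible real rank n − 1 + 2 is attained, and it is attained on a set with nonempty interior, i.e., it is typical). -/

import Mathlib

open scoped BigOperators
open MvPolynomial

/-- The real rank of `p` with respect to a subset `S` of a real vector space:
the least `r : ℕ∞` such that `p` is a sum of `r` elements of `S` (`∞` if none exists). -/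
noncomputable def realRank {V : Type*} [AddCommMonoid V] (S : Set V) (p : V) : ℕ∞ :=
  sInf ((fun n : ℕ => (n : ℕ∞)) ''
    {r : ℕ | ∃ x : Fin r → V, (∀ i, x i ∈ S) ∧ ∑ i, x i = p})

/-- The real zero set `V_ℝ(I) ⊆ ℝ^{n+1}` of an ideal `I ⊆ ℝ[x₀,…,x_n]`. -/
def realVariety {n : ℕ} (I : Ideal (MvPolynomial (Fin (n + 1)) ℝ)) : Set (Fin (n + 1) → ℝ) :=
  {x | ∀ f ∈ I, eval x f = 0}


/-- The real solution `y` of `4 y ^ 3 + 3 y = x`. -/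
noncomputable def cubicRoot (x : ℝ) : ℝ := Real.sinh (Real.arsinh x / 3)

lemma cubicRoot_spec (x : ℝ) : 4 * cubicRoot x ^ 3 + 3 * cubicRoot x = x := by
  rw [cubicRoot, ← Real.sinh_three_mul, mul_div_cancel₀ _ (by norm_num), Real.sinh_arsinh]

lemma four_mul_cube_add_injective {a : ℝ} (ha : 0 ≤ a) :
    Function.Injective fun y : ℝ => 4 * y ^ 3 + a * y := by
  intro x y hxy
  have h : (x - y) * (4 * (x ^ 2 + x * y + y ^ 2) + a) = 0 := by
    linear_combination hxy
  rcases mul_eq_zero.mp h with h | h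
  · linarith
  · have hx : x = 0 := by nlinarith [sq_nonneg (x + y), sq_nonneg x, sq_nonneg y]
    have hy : y = 0 := by nlinarith [sq_nonneg (x + y), sq_nonneg x, sq_nonneg y]
    rw [hx, hy]

lemma cubicRoot_neg (x : ℝ) : cubicRoot (-x) = -cubicRoot x := by
  simp [cubicRoot, neg_div]

lemma three_mul_abs_cubicRoot_le (x : ℝ) : 3 * |cubicRoot x| ≤ |x| := by
  have h : x = cubicRoot x * (4 * cubicRoot x ^ 2 + 3) := by
    linear_combination -cubicRoot_spec x
  have h2 : |x| = |cubicRoot x| * (4 * cubicRoot x ^ 2 + 3) := by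
    conv_lhs => rw [h]
    rw [abs_mul, abs_of_pos (a := 4 * cubicRoot x ^ 2 + 3) (by positivity)]
  rw [h2]
  nlinarith [abs_nonneg (cubicRoot x), sq_nonneg (cubicRoot x),
    mul_nonneg (abs_nonneg (cubicRoot x)) (sq_nonneg (cubicRoot x))]

lemma analyticAt_cubicRoot (x : ℝ) : AnalyticAt ℝ cubicRoot x := by
  have h : ContDiff ℝ ⊤ cubicRoot :=
    Real.contDiff_sinh.comp (Real.contDiff_arsinh.div_const 3)
  exact h.contDiffAt.analyticAt

/-- Odd power series expansion of `cubicRoot` at the origin. -/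
lemma exists_hasSum_cubicRoot : ∃ δ > (0 : ℝ), ∃ K : ℝ, ∃ a : ℕ → ℝ,
    (∀ j, Even j → a j = 0) ∧ (∀ j, |a j| * δ ^ j ≤ K) ∧
      ∀ x, |x| ≤ δ → HasSum (fun j => a j * x ^ j) (cubicRoot x) := by
  obtain ⟨p, hp⟩ := analyticAt_cubicRoot 0
  rw [hasFPowerSeriesAt_iff] at hp
  obtain ⟨r, hr, hball⟩ := Metric.eventually_nhds_iff.mp hp
  set b : ℕ → ℝ := fun j => p.coeff j * (1 - (-1) ^ j) / 2 with hb
  have hsum : ∀ x, |x| ≤ r / 2 → HasSum (fun j => b j * x ^ j) (cubicRoot x) := by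
    intro x hx
    have h1 := hball (y := x) (by rw [Real.dist_0_eq_abs]; linarith)
    have h2 := hball (y := -x) (by rw [Real.dist_0_eq_abs, abs_neg]; linarith)
    have h3 := (h1.sub h2).div_const 2
    simp only [zero_add, cubicRoot_neg, smul_eq_mul] at h3
    have e1 : (fun j => b j * x ^ j) =
        fun j => (x ^ j * p.coeff j - (-x) ^ j * p.coeff j) / 2 := by
      funext j
      rw [neg_pow x j]
      simp only [hb]
      ring
    have e2 : cubicRoot x = (cubicRoot x - -cubicRoot x) / 2 := by ring
    rw [e1, e2]
    exact h3
  have hs := hsum (r / 2) (by rw [abs_of_pos (by positivity)])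
  have hbdd := hs.summable.abs.tendsto_atTop_zero.bddAbove_range
  obtain ⟨K, hK⟩ := hbdd
  refine ⟨r / 2, by positivity, K, b, ?_, ?_, hsum⟩
  · intro j hj
    simp [hb, hj.neg_one_pow]
  · intro j
    have : |b j * (r / 2) ^ j| ≤ K := hK ⟨j, rfl⟩
    rwa [abs_mul, abs_pow, abs_of_pos (a := r / 2) (by positivity)] at this

/-- `φ` can be interpolated at any at most `m` points of the unit circle by a polynomial of
degree less than `m` whose coefficients have absolute sum at most `B`. -/
def InterpBound (m : ℕ) (φ : ℂ → ℂ) (B : ℝ) : Prop :=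
  ∀ T : Finset ℂ, T.card ≤ m → (∀ z ∈ T, ‖z‖ = 1) →
    ∃ b : ℕ → ℂ, (∑ j ∈ Finset.range m, ‖b j‖ ≤ B) ∧
      ∀ z ∈ T, ∑ j ∈ Finset.range m, b j * z ^ j = φ z

namespace InterpBound

variable {m : ℕ} {φ ψ : ℂ → ℂ} {A B : ℝ}

lemma mono (h : InterpBound m φ A) (hAB : A ≤ B) : InterpBound m φ B := by
  intro T hT hz
  obtain ⟨b, hb, h⟩ := h T hT hz
  exact ⟨b, hb.trans hAB, h⟩

lemma congr (h : InterpBound m φ A) (hφ : ∀ z, ‖z‖ = 1 → φ z = ψ z) : InterpBound m ψ A := by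
  intro T hT hz
  obtain ⟨b, hb, h⟩ := h T hT hz
  exact ⟨b, hb, fun z hzT => (h z hzT).trans (hφ z (hz z hzT))⟩

lemma zero : InterpBound m (fun _ => 0) 0 := fun _ _ _ => ⟨fun _ => 0, by simp, by simp⟩

lemma add (hφ : InterpBound m φ A) (hψ : InterpBound m ψ B) :
    InterpBound m (fun z => φ z + ψ z) (A + B) := by
  intro T hT hz
  obtain ⟨b, hb, h⟩ := hφ T hT hz
  obtain ⟨c, hc, h'⟩ := hψ T hT hz
  refine ⟨fun j => b j + c j, ?_, fun z hzT => ?_⟩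
  · refine le_trans (Finset.sum_le_sum fun j _ => norm_add_le _ _) ?_
    rw [Finset.sum_add_distrib]
    exact add_le_add hb hc
  · simp only [add_mul, Finset.sum_add_distrib, h z hzT, h' z hzT]

lemma const_mul (c : ℂ) (hφ : InterpBound m φ A) :
    InterpBound m (fun z => c * φ z) (‖c‖ * A) := by
  intro T hT hz
  obtain ⟨b, hb, h⟩ := hφ T hT hz
  refine ⟨fun j => c * b j, ?_, fun z hzT => ?_⟩
  · simp only [norm_mul, ← Finset.mul_sum]
    gcongr
  · simp only [mul_assoc, ← Finset.mul_sum, h z hzT]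

lemma sum {ι : Type*} (s : Finset ι) {f : ι → ℂ → ℂ} {A : ι → ℝ}
    (h : ∀ i ∈ s, InterpBound m (f i) (A i)) :
    InterpBound m (fun z => ∑ i ∈ s, f i z) (∑ i ∈ s, A i) := by
  classical
  induction s using Finset.induction_on with
  | empty => simpa using zero
  | insert i s hi ih =>
    simp only [Finset.sum_insert hi]
    exact (h i (by simp)).add (ih fun j hj => h j (by simp [hj]))

lemma hasSum {f : ℕ → ℂ → ℂ} {A : ℕ → ℝ} (h : ∀ i, InterpBound m (f i) (A i))
    (hA : HasSum A B) (hf : ∀ z, ‖z‖ = 1 → HasSum (fun i => f i z) (φ z)) :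
    InterpBound m φ B := by
  intro T hT hz
  choose b hb h using fun i => h i T hT hz
  have hle : ∀ j ∈ Finset.range m, ∀ i, ‖b i j‖ ≤ A i := fun j hj i =>
    (Finset.single_le_sum (f := fun j => ‖b i j‖) (fun _ _ => norm_nonneg _) hj).trans (hb i)
  have hsn : ∀ j ∈ Finset.range m, Summable fun i => ‖b i j‖ := fun j hj =>
    Summable.of_nonneg_of_le (fun _ => norm_nonneg _) (hle j hj) hA.summable
  refine ⟨fun j => ∑' i, b i j, ?_, fun z hzT => ?_⟩
  · calc ∑ j ∈ Finset.range m, ‖∑' i, b i j‖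
        ≤ ∑ j ∈ Finset.range m, ∑' i, ‖b i j‖ :=
          Finset.sum_le_sum fun j hj => norm_tsum_le_tsum_norm (hsn j hj)
      _ = ∑' i, ∑ j ∈ Finset.range m, ‖b i j‖ := (Summable.tsum_finsetSum hsn).symm
      _ ≤ B := hasSum_le hb (hasSum_sum (f := fun j i => ‖b i j‖)
          (a := fun j => ∑' i, ‖b i j‖) fun j hj => (hsn j hj).hasSum).summable.hasSum hA
  · have h1 : HasSum (fun i => ∑ j ∈ Finset.range m, b i j * z ^ j)
        (∑ j ∈ Finset.range m, (∑' i, b i j) * z ^ j) :=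
      hasSum_sum fun j hj => (hsn j hj).of_norm.hasSum.mul_right _
    simp only [h _ z hzT] at h1
    exact h1.unique (hf z (hz z hzT))

/-- Newton interpolation: adding one node. -/
lemma succ (hB : 0 ≤ B) (h : ∀ u : ℂ, ‖u‖ = 1 → ∃ χ : ℂ → ℂ, InterpBound m χ B ∧
      ∀ z, ‖z‖ = 1 → φ z = φ u + (z - u) * χ z) (hφ : ∀ z, ‖z‖ = 1 → ‖φ z‖ ≤ 1) :
    InterpBound (m + 1) φ (1 + 2 * B) := by
  classical
  intro T hT hz
  rcases T.eq_empty_or_nonempty with rfl | ⟨u, hu⟩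
  · exact ⟨fun _ => 0, by simp; positivity, by simp⟩
  obtain ⟨χ, hχ, hφχ⟩ := h u (hz u hu)
  obtain ⟨b, hb, hbT⟩ := hχ (T.erase u)
    (by rw [Finset.card_erase_of_mem hu]; omega) fun z hzT => hz z (Finset.mem_of_mem_erase hzT)
  have hu1 := hz u hu
  let b₀ : ℕ → ℂ := fun j => if j < m then b j else 0
  let c : ℕ → ℂ := fun j => if j = 0 then φ u - u * b₀ 0 else b₀ (j - 1) - u * b₀ j
  have hbm : b₀ m = 0 := by simp [b₀]
  have hsum : ∀ z : ℂ, ∑ j ∈ Finset.range m, b j * z ^ j =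
      ∑ j ∈ Finset.range m, b₀ j * z ^ j := fun z =>
    Finset.sum_congr rfl fun j hj => by simp [b₀, Finset.mem_range.mp hj]
  have hnorm : ∑ j ∈ Finset.range m, ‖b j‖ = ∑ j ∈ Finset.range m, ‖b₀ j‖ :=
    Finset.sum_congr rfl fun j hj => by simp [b₀, Finset.mem_range.mp hj]
  have hc0 : c 0 = φ u - u * b₀ 0 := by simp [c]
  have hcs : ∀ j, c (j + 1) = b₀ j - u * b₀ (j + 1) := fun j => by simp [c]
  have hval : ∀ z : ℂ, ∑ j ∈ Finset.range (m + 1), c j * z ^ j =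
      φ u + (z - u) * ∑ j ∈ Finset.range m, b j * z ^ j := by
    intro z
    have h1 : ∑ j ∈ Finset.range (m + 1), b₀ j * z ^ j = ∑ j ∈ Finset.range m, b₀ j * z ^ j := by
      rw [Finset.sum_range_succ, hbm]; simp
    rw [Finset.sum_range_succ'] at h1
    have h2 : z * ∑ j ∈ Finset.range m, b₀ j * z ^ j =
        ∑ j ∈ Finset.range m, b₀ j * z ^ (j + 1) := by
      rw [Finset.mul_sum]
      exact Finset.sum_congr rfl fun j _ => by ring
    have h3 : ∑ j ∈ Finset.range m, c (j + 1) * z ^ (j + 1) =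
        ∑ j ∈ Finset.range m, b₀ j * z ^ (j + 1) -
          u * ∑ j ∈ Finset.range m, b₀ (j + 1) * z ^ (j + 1) := by
      rw [Finset.mul_sum, ← Finset.sum_sub_distrib]
      exact Finset.sum_congr rfl fun j _ => by rw [hcs]; ring
    rw [hsum, Finset.sum_range_succ', h3, hc0]
    linear_combination -u * h1 - h2
  refine ⟨c, ?_, fun z hzT => ?_⟩
  · have h1 : ∑ j ∈ Finset.range (m + 1), ‖b₀ j‖ = ∑ j ∈ Finset.range m, ‖b₀ j‖ := by
      rw [Finset.sum_range_succ, hbm]; simp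
    have h2 : ∀ j, ‖c (j + 1)‖ ≤ ‖b₀ j‖ + ‖b₀ (j + 1)‖ := fun j => by
      rw [hcs]
      exact (norm_sub_le _ _).trans (by rw [norm_mul, hu1, one_mul])
    have h3 : ‖c 0‖ ≤ 1 + ‖b₀ 0‖ := by
      rw [hc0]
      refine (norm_sub_le _ _).trans ?_
      rw [norm_mul, hu1, one_mul]
      gcongr
      exact hφ u hu1
    rw [Finset.sum_range_succ']
    have h4 := Finset.sum_le_sum (s := Finset.range m) fun j _ => h2 j
    rw [Finset.sum_add_distrib] at h4
    have h5 := Finset.sum_range_succ' (fun j => ‖b₀ j‖) m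
    rw [h1] at h5
    linarith
  · rw [hval]
    by_cases hzu : z = u
    · simp [hzu]
    · rw [hbT z (Finset.mem_erase.mpr ⟨hzu, hzT⟩), hφχ z (hz z hzT)]

end InterpBound
namespace InterpBound

variable {m : ℕ} {φ : ℂ → ℂ} {A : ℝ}

lemma sum_two_pow_mul_le (k : ℕ) {C : ℝ} (hC : 0 ≤ C) :
    ∑ j ∈ Finset.range k, C * 2 ^ j ≤ C * 2 ^ k := by
  rw [← Finset.mul_sum]
  gcongr
  have := geom_sum_mul (2 : ℝ) k
  linarith

lemma zpow (m : ℕ) (k : ℤ) :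
    InterpBound m (fun z => z ^ k) (5 ^ m * 2 ^ k.natAbs) := by
  induction m generalizing k with
  | zero =>
    intro T hT _
    refine ⟨fun _ => 0, by simp, ?_⟩
    simp [Finset.card_eq_zero.mp (Nat.le_zero.mp hT)]
  | succ m ih =>
    have key := succ (m := m) (φ := fun z => z ^ k) (B := 5 ^ m * 2 ^ (k.natAbs + 1))
      (by positivity) ?_ (fun z hz => by simp [norm_zpow, hz])
    · refine key.mono ?_
      have h1 : (1 : ℝ) ≤ 5 ^ m * 2 ^ k.natAbs :=
        one_le_mul_of_one_le_of_one_le (one_le_pow₀ (by norm_num)) (one_le_pow₀ (by norm_num))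
      rw [pow_succ, pow_succ]
      linarith
    · intro u hu
      have hu0 : u ≠ 0 := norm_ne_zero_iff.mp (by rw [hu]; exact one_ne_zero)
      obtain ⟨l, rfl | rfl⟩ := k.eq_nat_or_neg
      · refine ⟨fun z => ∑ i ∈ Finset.range l, u ^ (l - 1 - i) * z ^ (i : ℤ), ?_, fun z hz => ?_⟩
        · refine (InterpBound.sum (Finset.range l) fun (i : ℕ) _ =>
            (ih (i : ℤ)).const_mul (u ^ (l - 1 - i))).mono ?_
          simp only [norm_pow, hu, one_pow, one_mul, Int.natAbs_natCast]
          refine (sum_two_pow_mul_le l (by positivity)).trans ?_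
          gcongr <;> simp
        · simp only [zpow_natCast]
          have h := Commute.mul_geom_sum₂ (Commute.all z u) l
          simp only [mul_comm (u ^ _)]
          linear_combination -h
      · refine ⟨fun z => ∑ i ∈ Finset.range l, -(u⁻¹ ^ (l - i)) * z ^ (-((i + 1 : ℕ) : ℤ)),
          ?_, fun z hz => ?_⟩
        · refine (InterpBound.sum (Finset.range l) fun (i : ℕ) _ =>
            (ih (-((i + 1 : ℕ) : ℤ))).const_mul (-(u⁻¹ ^ (l - i)))).mono ?_
          simp only [norm_neg, norm_pow, norm_inv, hu, inv_one, one_pow, one_mul, Int.natAbs_neg,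
            Int.natAbs_natCast]
          have := sum_two_pow_mul_le l (C := 5 ^ m * 2) (by positivity)
          calc _ = ∑ j ∈ Finset.range l, (5 ^ m * 2 : ℝ) * 2 ^ j :=
                Finset.sum_congr rfl fun j _ => by ring
            _ ≤ _ := this
            _ = _ := by ring
        · have hz0 : z ≠ 0 := norm_ne_zero_iff.mp (by rw [hz]; exact one_ne_zero)
          simp only [zpow_neg, zpow_natCast, ← inv_pow]
          have h := Commute.mul_geom_sum₂ (Commute.all z⁻¹ u⁻¹) l
          have h2 : ∑ i ∈ Finset.range l, -u⁻¹ ^ (l - i) * z⁻¹ ^ (i + 1) =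
              -(z⁻¹ * u⁻¹) * ∑ i ∈ Finset.range l, z⁻¹ ^ i * u⁻¹ ^ (l - 1 - i) := by
            rw [Finset.mul_sum]
            refine Finset.sum_congr rfl fun i hi => ?_
            have : l - i = l - 1 - i + 1 := by have := Finset.mem_range.mp hi; omega
            rw [this]
            ring
          have h3 : (z - u) * -(z⁻¹ * u⁻¹) = z⁻¹ - u⁻¹ := by field_simp; ring
          rw [h2, ← mul_assoc, h3, h]
          ring

lemma mul_half_one_add (h : ∀ k : ℤ, InterpBound m (fun z => φ z * z ^ k) (A * 2 ^ k.natAbs))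
    (hA : 0 ≤ A) (k : ℤ) :
    InterpBound m (fun z => (φ z * ((1 + z) / 2)) * z ^ k) (A * 2 * 2 ^ k.natAbs) := by
  have h1 := ((h k).add (h (k + 1))).const_mul (1 / 2)
  refine (h1.congr fun z hz => ?_).mono ?_
  · have hz0 : z ≠ 0 := norm_ne_zero_iff.mp (by rw [hz]; exact one_ne_zero)
    rw [zpow_add_one₀ hz0]
    ring
  · have h2 : (2 : ℝ) ^ (k + 1).natAbs ≤ 2 ^ k.natAbs * 2 := by
      rw [← pow_succ]
      exact pow_le_pow_right₀ (by norm_num) (by omega)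
    have h3 := mul_le_mul_of_nonneg_left h2 hA
    have h4 : 0 ≤ A * 2 ^ k.natAbs := by positivity
    norm_num
    linarith

lemma mul_quarter (h : ∀ k : ℤ, InterpBound m (fun z => φ z * z ^ k) (A * 2 ^ k.natAbs))
    (hA : 0 ≤ A) (k : ℤ) :
    InterpBound m (fun z => (φ z * ((2 + z + z⁻¹) / 4)) * z ^ k) (A * 2 * 2 ^ k.natAbs) := by
  have h1 := (((h k).const_mul 2).add ((h (k + 1)).add (h (k - 1)))).const_mul (1 / 4)
  refine (h1.congr fun z hz => ?_).mono ?_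
  · have hz0 : z ≠ 0 := norm_ne_zero_iff.mp (by rw [hz]; exact one_ne_zero)
    rw [zpow_add_one₀ hz0, zpow_sub_one₀ hz0]
    ring
  · have h2 : (2 : ℝ) ^ (k + 1).natAbs ≤ 2 ^ k.natAbs * 2 := by
      rw [← pow_succ]
      exact pow_le_pow_right₀ (by norm_num) (by omega)
    have h2' : (2 : ℝ) ^ (k - 1).natAbs ≤ 2 ^ k.natAbs * 2 := by
      rw [← pow_succ]
      exact pow_le_pow_right₀ (by norm_num) (by omega)
    have h3 := mul_le_mul_of_nonneg_left h2 hA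
    have h3' := mul_le_mul_of_nonneg_left h2' hA
    have h4 : 0 ≤ A * 2 ^ k.natAbs := by positivity
    norm_num
    linarith

lemma pow_mul_pow (m a b : ℕ) (k : ℤ) :
    InterpBound m (fun z => (((1 + z) / 2) ^ a * ((2 + z + z⁻¹) / 4) ^ b) * z ^ k)
      (5 ^ m * 2 ^ (a + b) * 2 ^ k.natAbs) := by
  induction b generalizing k with
  | zero =>
    induction a generalizing k with
    | zero => simpa using zpow m k
    | succ a ih =>
      convert mul_half_one_add ih (by positivity) k using 2 <;> ring
  | succ b ih =>
    convert mul_quarter ih (by positivity) k using 2 <;> ring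

end InterpBound

lemma exp_mul_cos_pow (d l : ℕ) (θ : ℝ) :
    ((1 + Complex.exp (2 * θ * Complex.I)) / 2) ^ d *
      ((2 + Complex.exp (2 * θ * Complex.I) + (Complex.exp (2 * θ * Complex.I))⁻¹) / 4) ^
        (d * (3 * l + 1)) =
      Complex.exp (θ * Complex.I) ^ d * (Real.cos θ : ℂ) ^ (3 * d * (2 * l + 1)) := by
  have h1 : Complex.exp (2 * θ * Complex.I) = Complex.exp (θ * Complex.I) ^ 2 := by
    rw [← Complex.exp_nat_mul]
    push_cast
    ring_nf
  have h0 := Complex.exp_ne_zero (θ * Complex.I)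
  have h2 : (Real.cos θ : ℂ) =
      (Complex.exp (θ * Complex.I) + (Complex.exp (θ * Complex.I))⁻¹) / 2 := by
    rw [Complex.ofReal_cos, Complex.cos, ← Complex.exp_neg, neg_mul]
  rw [h1, h2]
  set w := Complex.exp (θ * Complex.I)
  have h3 : (1 + w ^ 2) / 2 = w * ((w + w⁻¹) / 2) := by field_simp; ring
  have h4 : (2 + w ^ 2 + (w ^ 2)⁻¹) / 4 = ((w + w⁻¹) / 2) ^ 2 := by field_simp; ring
  rw [h3, h4]
  generalize (w + w⁻¹) / 2 = c
  ring

/-- For small `ε` the functions `(e ^ (2 i θ)) ^ j`, `j < m`, interpolate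
`e ^ (i d θ) * cubicRoot (ε cos ^ (3 d) θ)` at any `m` points with uniformly bounded
coefficients. -/
lemma exists_interpolation_bound (d m : ℕ) : ∃ ε > (0 : ℝ), ∃ B : ℝ,
    ∀ (r : ℕ) (θ : Fin r → ℝ), r ≤ m → ∃ b : ℕ → ℂ, (∑ j ∈ Finset.range m, ‖b j‖ ≤ B) ∧
      ∀ i, ∑ j ∈ Finset.range m, b j * Complex.exp (2 * θ i * Complex.I) ^ j =
        Complex.exp (θ i * Complex.I) ^ d * (cubicRoot (ε * Real.cos (θ i) ^ (3 * d)) : ℂ) := by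
  classical
  obtain ⟨δ, hδ, K, a, ha0, haK, hsum⟩ := exists_hasSum_cubicRoot
  set ε := δ / 2 ^ (3 * d + 1) with hε
  have hε0 : 0 < ε := by positivity
  have hεδ : ε ≤ δ := div_le_self hδ.le (one_le_pow₀ (by norm_num))
  let F : ℕ → ℂ → ℂ := fun j z => ((a j * ε ^ j : ℝ) : ℂ) *
    (((1 + z) / 2) ^ d * ((2 + z + z⁻¹) / 4) ^ (d * (3 * (j / 2) + 1)))
  have hF : ∀ j, InterpBound m (F j) (5 ^ m * K * (1 / 2) ^ j) := by
    intro j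
    have hK : 0 ≤ K := (by positivity : 0 ≤ |a j| * δ ^ j).trans (haK j)
    rcases Nat.even_or_odd j with hj | hj
    · refine (InterpBound.zero.congr fun z _ => ?_).mono (by positivity)
      simp [F, ha0 j hj]
    · have h := (InterpBound.pow_mul_pow m d (d * (3 * (j / 2) + 1)) 0).const_mul
        ((a j * ε ^ j : ℝ) : ℂ)
      refine (h.congr fun z _ => by simp [F]).mono ?_
      obtain ⟨l, rfl⟩ := hj
      have hl : (2 * l + 1) / 2 = l := by omega
      rw [hl, Complex.norm_real, Real.norm_eq_abs, abs_mul, abs_pow, abs_of_pos hε0]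
      have h1 : (2 : ℝ) ^ (d + d * (3 * l + 1)) ≤ (2 ^ (3 * d)) ^ (2 * l + 1) := by
        rw [← pow_mul]
        exact pow_le_pow_right₀ (by norm_num) (by nlinarith)
      have h2 : ε * 2 ^ (3 * d) = δ * (1 / 2) := by
        rw [hε, pow_succ]
        field_simp
      calc |a (2 * l + 1)| * ε ^ (2 * l + 1) *
            (5 ^ m * 2 ^ (d + d * (3 * l + 1)) * 2 ^ (0 : ℤ).natAbs)
          ≤ |a (2 * l + 1)| * ε ^ (2 * l + 1) *
            (5 ^ m * (2 ^ (3 * d)) ^ (2 * l + 1) * 2 ^ (0 : ℤ).natAbs) := by gcongr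
        _ = 5 ^ m * (|a (2 * l + 1)| * (ε * 2 ^ (3 * d)) ^ (2 * l + 1)) := by
          rw [mul_pow]; simp; ring
        _ = 5 ^ m * (|a (2 * l + 1)| * δ ^ (2 * l + 1)) * (1 / 2) ^ (2 * l + 1) := by
          rw [h2, mul_pow]; ring
        _ ≤ _ := by
          gcongr
          exact haK _
  have hA : HasSum (fun j : ℕ => 5 ^ m * K * (1 / 2 : ℝ) ^ j) (5 ^ m * K * 2) :=
    hasSum_geometric_two.mul_left _
  have hval : ∀ θ : ℝ, HasSum (fun j => F j (Complex.exp (2 * θ * Complex.I)))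
      (Complex.exp (θ * Complex.I) ^ d * (cubicRoot (ε * Real.cos θ ^ (3 * d)) : ℂ)) := by
    intro θ
    have hx : |ε * Real.cos θ ^ (3 * d)| ≤ δ := by
      rw [abs_mul, abs_of_pos hε0, abs_pow]
      calc ε * |Real.cos θ| ^ (3 * d) ≤ ε * 1 := by
            gcongr
            exact pow_le_one₀ (abs_nonneg _) (Real.abs_cos_le_one θ)
        _ ≤ δ := by linarith
    have h := (Complex.hasSum_ofReal.mpr (hsum _ hx)).mul_left (Complex.exp (θ * Complex.I) ^ d)
    have hfun : (fun j => F j (Complex.exp (2 * θ * Complex.I))) = fun j =>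
        Complex.exp (θ * Complex.I) ^ d *
          ((a j * (ε * Real.cos θ ^ (3 * d)) ^ j : ℝ) : ℂ) := by
      funext j
      rcases Nat.even_or_odd j with hj | ⟨l, rfl⟩
      · simp [F, ha0 j hj]
      · have hl : (2 * l + 1) / 2 = l := by omega
        simp only [F, hl, exp_mul_cos_pow]
        push_cast
        ring
    rw [hfun]
    exact h
  have hsurj : ∀ z : ℂ, ‖z‖ = 1 → ∃ θ : ℝ, z = Complex.exp (2 * θ * Complex.I) := by
    intro z hz
    refine ⟨z.arg / 2, ?_⟩
    have h := Complex.norm_mul_exp_arg_mul_I z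
    rw [hz, Complex.ofReal_one, one_mul] at h
    conv_lhs => rw [← h]
    congr 1
    push_cast
    ring
  have hint : InterpBound m (fun z => ∑' j, F j z) (5 ^ m * K * 2) := by
    refine InterpBound.hasSum hF hA fun z hz => ?_
    obtain ⟨θ, rfl⟩ := hsurj z hz
    exact (hval θ).summable.hasSum
  refine ⟨ε, hε0, 5 ^ m * K * 2, fun r θ hr => ?_⟩
  obtain ⟨b, hb, h⟩ := hint
    (Finset.univ.image fun i => Complex.exp (2 * θ i * Complex.I))
    (Finset.card_image_le.trans (by simpa using hr)) (by
      intro z hz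
      obtain ⟨i, -, rfl⟩ := Finset.mem_image.mp hz
      have := Complex.norm_exp_ofReal_mul_I (2 * θ i)
      push_cast at this
      exact this)
  refine ⟨b, hb, fun i => ?_⟩
  rw [h _ (Finset.mem_image_of_mem _ (Finset.mem_univ i))]
  exact (hval (θ i)).tsum_eq
/-- The restriction of polynomials to the line spanned by `x`. -/
noncomputable def restrictLine {σ : Type*} (x : σ → ℝ) : MvPolynomial σ ℝ →ₐ[ℝ] Polynomial ℝ :=
  aeval fun i => Polynomial.C (x i) * Polynomial.X

lemma eval_restrictLine {σ : Type*} (x : σ → ℝ) (f : MvPolynomial σ ℝ) (c : ℝ) :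
    (restrictLine x f).eval c = eval (c • x) f := by
  rw [restrictLine, ← Polynomial.coe_evalRingHom, map_aeval, coe_eval₂Hom, eval₂_eq, eval_eq]
  simp [mul_comm c]

lemma coeff_restrictLine {σ : Type*} (x : σ → ℝ) (f : MvPolynomial σ ℝ) (k : ℕ) :
    (restrictLine x f).coeff k = eval x (homogeneousComponent k f) := by
  induction f using MvPolynomial.induction_on' with
  | monomial u a =>
    have h : monomial u a ∈ homogeneousSubmodule σ ℝ u.degree :=
      isHomogeneous_monomial a rfl
    rw [homogeneousComponent_of_mem h, restrictLine, aeval_monomial]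
    simp only [mul_pow, Finsupp.prod_mul, Polynomial.algebraMap_eq]
    have h1 : (u.prod fun _ k => (Polynomial.X : Polynomial ℝ) ^ k) = Polynomial.X ^ u.degree := by
      rw [Finsupp.prod, Finset.prod_pow_eq_pow_sum]
      rfl
    have h2 : (u.prod fun i k => Polynomial.C (x i) ^ k) =
        Polynomial.C (u.prod fun i k => x i ^ k) := by
      simp [Finsupp.prod]
    rw [h1, h2, ← mul_assoc, ← Polynomial.C_mul, Polynomial.coeff_C_mul_X_pow]
    split_ifs <;> simp [eval_monomial]
  | add p q hp hq => simp [hp, hq]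

/-- The curve `θ ↦ (cos ^ d θ, cos ^ (d - 1) θ sin θ, …, sin ^ d θ, cubicRoot (ε cos ^ (3 d) θ))`,
a section of the cone over our projective curve. -/
noncomputable def curvePoint (d : ℕ) (ε θ : ℝ) : Fin (d + 1 + 1) → ℝ :=
  Fin.snoc (α := fun _ => ℝ)
    (fun i : Fin (d + 1) => Real.cos θ ^ (d - (i : ℕ)) * Real.sin θ ^ (i : ℕ))
    (cubicRoot (ε * Real.cos θ ^ (3 * d)))

@[simp]
lemma curvePoint_castSucc (d : ℕ) (ε θ : ℝ) (i : Fin (d + 1)) :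
    curvePoint d ε θ i.castSucc = Real.cos θ ^ (d - (i : ℕ)) * Real.sin θ ^ (i : ℕ) := by
  simp [curvePoint]

@[simp]
lemma curvePoint_last (d : ℕ) (ε θ : ℝ) :
    curvePoint d ε θ (Fin.last (d + 1)) = cubicRoot (ε * Real.cos θ ^ (3 * d)) := by
  simp [curvePoint]

/-- The cone over the curve. -/
def curveCone (d : ℕ) (ε : ℝ) : Set (Fin (d + 1 + 1) → ℝ) :=
  {x | ∃ c θ : ℝ, x = c • curvePoint d ε θ}

/-- The homogeneous ideal of the curve. -/
noncomputable def curveIdeal (d : ℕ) (ε : ℝ) : Ideal (MvPolynomial (Fin (d + 1 + 1)) ℝ) :=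
  vanishingIdeal ℝ (curveCone d ε)

section curve

variable {d : ℕ} {ε : ℝ} {f g : MvPolynomial (Fin (d + 1 + 1)) ℝ}

lemma mem_curveIdeal_iff : f ∈ curveIdeal d ε ↔ ∀ c θ : ℝ, eval (c • curvePoint d ε θ) f = 0 := by
  rw [curveIdeal, mem_vanishingIdeal_iff]
  simp only [aeval_eq_eval]
  constructor
  · exact fun h c θ => h _ ⟨c, θ, rfl⟩
  · rintro h _ ⟨c, θ, rfl⟩
    exact h c θ

lemma mem_curveIdeal_iff_restrictLine :
    f ∈ curveIdeal d ε ↔ ∀ θ : ℝ, restrictLine (curvePoint d ε θ) f = 0 := by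
  rw [mem_curveIdeal_iff, forall_comm]
  refine forall_congr' fun θ => ?_
  simp only [← eval_restrictLine]
  exact ⟨fun h => Polynomial.funext (by simpa using h), fun h c => by simp [h]⟩

lemma homogeneousComponent_mem_curveIdeal (hf : f ∈ curveIdeal d ε) (k : ℕ) :
    homogeneousComponent k f ∈ curveIdeal d ε := by
  rw [mem_curveIdeal_iff_restrictLine] at hf ⊢
  intro θ
  ext l
  have h : eval (curvePoint d ε θ) (homogeneousComponent k f) = 0 := by
    rw [← coeff_restrictLine, hf θ, Polynomial.coeff_zero]
  rw [coeff_restrictLine, homogeneousComponent_of_mem (homogeneousComponent_mem k f)]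
  split_ifs <;> simp [h]

lemma analyticOnNhd_eval_curvePoint (f : MvPolynomial (Fin (d + 1 + 1)) ℝ) :
    AnalyticOnNhd ℝ (fun p : ℝ × ℝ => eval (p.1 • curvePoint d ε p.2) f) Set.univ := by
  simp only [← aeval_eq_eval]
  refine AnalyticOnNhd.aeval_mvPolynomial (fun i p _ => ?_) f
  have hcos : AnalyticAt ℝ (fun p : ℝ × ℝ => Real.cos p.2) p :=
    Real.analyticAt_cos.comp analyticAt_snd
  have hsin : AnalyticAt ℝ (fun p : ℝ × ℝ => Real.sin p.2) p :=
    Real.analyticAt_sin.comp analyticAt_snd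
  induction i using Fin.lastCases with
  | last =>
    simp only [Pi.smul_apply, curvePoint_last, smul_eq_mul]
    exact analyticAt_fst.mul
      ((analyticAt_cubicRoot _).comp (analyticAt_const.mul (hcos.pow (3 * d))))
  | cast i =>
    simp only [Pi.smul_apply, curvePoint_castSucc, smul_eq_mul]
    exact analyticAt_fst.mul ((hcos.pow _).mul (hsin.pow _))

lemma curveIdeal_isPrime (d : ℕ) (ε : ℝ) : (curveIdeal d ε).IsPrime := by
  refine ⟨?_, fun {f g} hfg => or_iff_not_imp_left.mpr fun hf => ?_⟩
  · rw [Ideal.ne_top_iff_one, mem_curveIdeal_iff]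
    simp
  · rw [mem_curveIdeal_iff] at hf hfg ⊢
    push Not at hf
    obtain ⟨c, θ, h⟩ := hf
    have hev := (analyticOnNhd_eval_curvePoint (ε := ε) f (c, θ)
      trivial).continuousAt.eventually_ne h
    have h0 : (fun p : ℝ × ℝ => eval (p.1 • curvePoint d ε p.2) g) = fun _ => 0 := by
      refine (analyticOnNhd_eval_curvePoint g).eq_of_eventuallyEq analyticOnNhd_const
        (z₀ := (c, θ)) ?_
      filter_upwards [hev] with p hp
      have := hfg p.1 p.2
      rw [map_mul] at this
      exact (mul_eq_zero.mp this).resolve_left hp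
    exact fun c θ => congrFun h0 (c, θ)

lemma quadric_mem_curveIdeal {i j k l : Fin (d + 1)} (h : (i : ℕ) + j = k + l) :
    (X i.castSucc * X j.castSucc - X k.castSucc * X l.castSucc :
      MvPolynomial (Fin (d + 1 + 1)) ℝ) ∈ curveIdeal d ε := by
  rw [mem_curveIdeal_iff]
  intro c θ
  simp only [map_sub, map_mul, eval_X, Pi.smul_apply, smul_eq_mul, curvePoint_castSucc]
  have h1 : d - (i : ℕ) + (d - j) = d - k + (d - l) := by omega
  have h2 := congrArg (fun e => Real.cos θ ^ e) h1
  have h3 := congrArg (fun e => Real.sin θ ^ e) h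
  simp only [pow_add] at h2 h3
  linear_combination c ^ 2 * Real.sin θ ^ (i : ℕ) * Real.sin θ ^ (j : ℕ) * h2 +
    c ^ 2 * Real.cos θ ^ (d - (k : ℕ)) * Real.cos θ ^ (d - (l : ℕ)) * h3

lemma sum_choose_mul_sq (d : ℕ) (θ : ℝ) :
    ∑ j : Fin (d + 1), (d.choose j : ℝ) * (Real.cos θ ^ (d - (j : ℕ)) * Real.sin θ ^ (j : ℕ)) ^ 2 =
      1 := by
  have h := add_pow (Real.sin θ ^ 2) (Real.cos θ ^ 2) d
  rw [Real.sin_sq_add_cos_sq, one_pow, Finset.sum_range] at h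
  rw [h]
  exact Finset.sum_congr rfl fun j _ => by ring

/-- The cubic relation satisfied by the last coordinate. -/
noncomputable def curveCubic (d : ℕ) (ε : ℝ) : MvPolynomial (Fin (d + 1 + 1)) ℝ :=
  C 4 * X (Fin.last (d + 1)) ^ 3 +
    C 3 * (∑ j : Fin (d + 1), C (d.choose j : ℝ) * X j.castSucc ^ 2) * X (Fin.last (d + 1)) -
    C ε * X (Fin.castSucc 0) ^ 3

lemma curveCubic_mem_curveIdeal (d : ℕ) (ε : ℝ) : curveCubic d ε ∈ curveIdeal d ε := by
  rw [mem_curveIdeal_iff]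
  intro c θ
  have h1 := sum_choose_mul_sq d θ
  have h2 := cubicRoot_spec (ε * Real.cos θ ^ (3 * d))
  simp only [curveCubic, map_sub, map_add, map_mul, map_sum, map_pow, eval_X, eval_C,
    Pi.smul_apply, smul_eq_mul, curvePoint_castSucc, curvePoint_last, Fin.val_zero, pow_zero,
    mul_pow c, mul_left_comm _ (c ^ 2), ← Finset.mul_sum, h1]
  rw [mul_comm 3 d, pow_mul] at h2 ⊢
  simp only [Nat.sub_zero, mul_one]
  linear_combination c ^ 3 * h2

lemma realVariety_curveIdeal (hd : 1 ≤ d) : realVariety (curveIdeal d ε) = curveCone d ε := by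
  refine Set.Subset.antisymm (fun x hx => ?_) ?_
  swap
  · rintro _ ⟨c, θ, rfl⟩ f hf
    exact mem_curveIdeal_iff.mp hf c θ
  set y : Fin (d + 1) → ℝ := fun i => x i.castSucc with hy
  have hquad : ∀ i j k l : Fin (d + 1), (i : ℕ) + j = k + l → y i * y j = y k * y l := by
    intro i j k l h
    have := hx _ (quadric_mem_curveIdeal h)
    simp only [map_sub, map_mul, eval_X] at this
    linarith
  have hpar : ∃ c θ : ℝ, ∀ i, y i = c * (Real.cos θ ^ (d - (i : ℕ)) * Real.sin θ ^ (i : ℕ)) := by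
    by_cases h0 : y 0 = 0
    · refine ⟨y (Fin.last d), Real.pi / 2, fun i => ?_⟩
      rw [Real.cos_pi_div_two, Real.sin_pi_div_two]
      induction i using Fin.lastCases with
      | last => simp
      | cast i =>
        have hz : ∀ i (hi : i < d), y ⟨i, by omega⟩ = 0 := by
          intro i
          induction i with
          | zero => exact fun _ => h0
          | succ i ih =>
            intro hi
            have := hquad ⟨i + 1, by omega⟩ ⟨i + 1, by omega⟩ ⟨i, by omega⟩ ⟨i + 2, by omega⟩
              (by simp; omega)
            rw [ih (by omega), zero_mul] at this
            exact mul_self_eq_zero.mp this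
        have hi := i.isLt
        have : d - (i : ℕ) ≠ 0 := by omega
        have hyi : y i.castSucc = 0 := hz i hi
        simp [this, hyi]
    · set τ := y ⟨1, by omega⟩ / y 0 with hτ
      have hy1 : y ⟨1, by omega⟩ = y 0 * τ := by
        rw [hτ]
        field_simp
      have hpow : ∀ i (hi : i < d + 1), y ⟨i, hi⟩ = y 0 * τ ^ i := by
        intro i
        induction i with
        | zero => simp
        | succ i ih =>
          intro hi
          have := hquad 0 ⟨i + 1, hi⟩ ⟨1, by omega⟩ ⟨i, by omega⟩ (by simp; omega)
          rw [ih (by omega), hy1] at this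
          refine mul_left_cancel₀ h0 ?_
          linear_combination this
      have hcos := (Real.cos_arctan_pos τ).ne'
      have hsin : Real.sin (Real.arctan τ) = τ * Real.cos (Real.arctan τ) := by
        have := Real.tan_mul_cos hcos
        rw [Real.tan_arctan] at this
        exact this.symm
      refine ⟨y 0 / Real.cos (Real.arctan τ) ^ d, Real.arctan τ, fun i => ?_⟩
      rw [hpow i i.isLt, hsin, mul_pow]
      have hi : (i : ℕ) ≤ d := by omega
      have hsplit : Real.cos (Real.arctan τ) ^ d =
          Real.cos (Real.arctan τ) ^ (d - (i : ℕ)) * Real.cos (Real.arctan τ) ^ (i : ℕ) := by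
        rw [← pow_add, Nat.sub_add_cancel hi]
      rw [hsplit]
      field_simp
  obtain ⟨c, θ, hcθ⟩ := hpar
  refine ⟨c, θ, ?_⟩
  have hcub := hx _ (curveCubic_mem_curveIdeal d ε)
  have hcub' := mem_curveIdeal_iff.mp (curveCubic_mem_curveIdeal d ε) c θ
  have hxy : ∀ i : Fin (d + 1), x i.castSucc = (c • curvePoint d ε θ) i.castSucc := by
    intro i
    simpa using hcθ i
  simp only [curveCubic, map_sub, map_add, map_mul, map_sum, map_pow, eval_X, eval_C, ← hxy]
    at hcub hcub'
  have hnonneg : 0 ≤ 3 * ∑ j : Fin (d + 1), (d.choose j : ℝ) * x j.castSucc ^ 2 := by positivity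
  funext i
  induction i using Fin.lastCases with
  | last => exact four_mul_cube_add_injective hnonneg (by dsimp only; linarith)
  | cast i => exact hxy i

end curve
section nondegenerate

variable {d : ℕ} {ε : ℝ}

lemma cubicRoot_ne_zero {x : ℝ} (hx : x ≠ 0) : cubicRoot x ≠ 0 := by
  intro h
  have := cubicRoot_spec x
  rw [h] at this
  exact hx (by simpa using this.symm)

lemma curvePoint_zero (d : ℕ) (ε : ℝ) (i : Fin (d + 1)) :
    curvePoint d ε 0 i.castSucc = if i = 0 then 1 else 0 := by
  simp [zero_pow_eq]

lemma eq_zero_of_forall_sum_mul_curvePoint (hd : 1 ≤ d) (hε : ε ≠ 0) {a : Fin (d + 1 + 1) → ℝ}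
    (h : ∀ θ, ∑ i, a i * curvePoint d ε θ i = 0) : a = 0 := by
  set P : Polynomial ℝ :=
    ∑ i : Fin (d + 1), Polynomial.C (a i.castSucc) * Polynomial.X ^ (i : ℕ) with hP
  set b := a (Fin.last (d + 1)) with hb
  have hbound : ∀ t : ℝ, ‖P.eval t‖ ≤ |b| * |ε| * Real.cos (Real.arctan t) ^ (2 * d) := by
    intro t
    have hcos := Real.cos_arctan_pos t
    have hsin : Real.sin (Real.arctan t) = t * Real.cos (Real.arctan t) := by
      have := Real.tan_mul_cos hcos.ne'
      rw [Real.tan_arctan] at this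
      exact this.symm
    have h1 := h (Real.arctan t)
    have h2 := three_mul_abs_cubicRoot_le (ε * Real.cos (Real.arctan t) ^ (3 * d))
    set y := cubicRoot (ε * Real.cos (Real.arctan t) ^ (3 * d)) with hy
    have h3 : ∑ i : Fin (d + 1), a i.castSucc * curvePoint d ε (Real.arctan t) i.castSucc =
        Real.cos (Real.arctan t) ^ d * P.eval t := by
      rw [hP, Polynomial.eval_finsetSum, Finset.mul_sum]
      refine Finset.sum_congr rfl fun i _ => ?_
      have hsplit : Real.cos (Real.arctan t) ^ d =
          Real.cos (Real.arctan t) ^ (d - (i : ℕ)) * Real.cos (Real.arctan t) ^ (i : ℕ) := by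
        rw [← pow_add, Nat.sub_add_cancel (by omega)]
      simp only [curvePoint_castSucc, hsin, mul_pow, hsplit, Polynomial.eval_mul,
        Polynomial.eval_C, Polynomial.eval_pow, Polynomial.eval_X]
      ring
    rw [Fin.sum_univ_castSucc, h3, curvePoint_last, ← hy, ← hb] at h1
    rw [abs_mul, abs_of_pos (pow_pos hcos _)] at h2
    have h4 : Real.cos (Real.arctan t) ^ d * |P.eval t| = |b| * |y| := by
      have h5 : Real.cos (Real.arctan t) ^ d * P.eval t = -(b * y) := by linarith
      rw [← abs_mul, ← abs_neg (b * y), ← h5, abs_mul, abs_of_pos (pow_pos hcos d)]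
    rw [Real.norm_eq_abs]
    refine le_of_mul_le_mul_left ?_ (pow_pos hcos d)
    rw [h4]
    have h5 : |y| ≤ |ε| * Real.cos (Real.arctan t) ^ (3 * d) := by
      have := abs_nonneg y
      linarith
    calc |b| * |y| ≤ |b| * (|ε| * Real.cos (Real.arctan t) ^ (3 * d)) := by gcongr
      _ = _ := by ring
  have hlim : Filter.Tendsto (fun t => P.eval t) Filter.atTop (nhds 0) := by
    refine squeeze_zero_norm hbound ?_
    have h1 : Filter.Tendsto (fun t => Real.cos (Real.arctan t)) Filter.atTop (nhds 0) := by
      rw [← Real.cos_pi_div_two]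
      exact (Real.continuous_cos.tendsto _).comp
        (Real.tendsto_arctan_atTop.mono_right nhdsWithin_le_nhds)
    have h2 := (h1.pow (2 * d)).const_mul (|b| * |ε|)
    rwa [zero_pow (by omega), mul_zero] at h2
  have hP0 : P = 0 := by
    rw [Polynomial.tendsto_nhds_iff] at hlim
    exact Polynomial.leadingCoeff_eq_zero.mp hlim.1
  have ha : ∀ i : Fin (d + 1), a i.castSucc = 0 := by
    intro i
    have := congrArg (fun p => p.coeff (i : ℕ)) hP0
    simpa [hP, Polynomial.finsetSum_coeff, Polynomial.coeff_X_pow, Fin.val_inj] using this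
  have hb0 : b = 0 := by
    have := h 0
    rw [Fin.sum_univ_castSucc] at this
    simpa [ha, cubicRoot_ne_zero hε] using this
  funext i
  induction i using Fin.lastCases with
  | last => exact hb0
  | cast i => exact ha i

lemma eq_zero_of_mem_curveIdeal_of_isHomogeneous_one (hd : 1 ≤ d) (hε : ε ≠ 0)
    {f : MvPolynomial (Fin (d + 1 + 1)) ℝ} (hf : f ∈ curveIdeal d ε)
    (hf1 : f ∈ homogeneousSubmodule (Fin (d + 1 + 1)) ℝ 1) : f = 0 := by
  rw [homogeneousSubmodule_one_eq_span_X, Submodule.mem_span_range_iff_exists_fun] at hf1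
  obtain ⟨a, rfl⟩ := hf1
  have ha : a = 0 := by
    refine eq_zero_of_forall_sum_mul_curvePoint hd hε fun θ => ?_
    have := mem_curveIdeal_iff.mp hf 1 θ
    simpa [smul_eval] using this
  simp [ha]

lemma span_curveCone (hd : 1 ≤ d) (hε : ε ≠ 0) : Submodule.span ℝ (curveCone d ε) = ⊤ := by
  by_contra hne
  obtain ⟨φ, hφ, hle⟩ := Submodule.exists_le_ker_of_lt_top _ (lt_top_iff_ne_top.mpr hne)
  refine hφ ?_
  have ha : (fun i => φ (Pi.single i 1)) = 0 := by
    refine eq_zero_of_forall_sum_mul_curvePoint hd hε fun θ => ?_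
    have h1 : curvePoint d ε θ ∈ LinearMap.ker φ :=
      hle (Submodule.subset_span ⟨1, θ, (one_smul _ _).symm⟩)
    rw [LinearMap.mem_ker, LinearMap.pi_apply_eq_sum_univ] at h1
    rw [← h1]
    refine Finset.sum_congr rfl fun i _ => ?_
    rw [smul_eq_mul, mul_comm]
    congr 2
    funext j
    simp [Pi.single_apply, eq_comm]
  refine LinearMap.pi_ext' fun i => ?_
  ext
  simpa using congrFun ha i

end nondegenerate
section krullDim

lemma IsIntegral.of_cubic {R S : Type*} [CommRing R] [CommRing S] [Algebra R S] {a b x : S}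
    (ha : IsIntegral R a) (hb : IsIntegral R b) (h : x ^ 3 + a * x + b = 0) : IsIntegral R x := by
  nontriviality S
  let a' : integralClosure R S := ⟨a, ha⟩
  let b' : integralClosure R S := ⟨b, hb⟩
  refine isIntegral_trans (A := integralClosure R S) x
    ⟨Polynomial.X ^ 3 + Polynomial.C a' * Polynomial.X + Polynomial.C b', ?_, ?_⟩
  · monicity!
  · simpa [a', b'] using h

lemma ringKrullDim_le_of_isIntegral (R S : Type*) [CommRing R] [CommRing S] [Algebra R S]
    [Algebra.IsIntegral R S] : ringKrullDim S ≤ ringKrullDim R :=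
  Order.krullDim_le_of_strictMono (PrimeSpectrum.comap (algebraMap R S)) fun p q hpq => by
    have := p.isPrime
    exact Ideal.IsIntegral.comap_lt_comap (R := R) (show p.asIdeal < q.asIdeal from hpq)

variable {d : ℕ} {ε : ℝ}

lemma X_pow_sub_mem_curveIdeal (i : Fin (d + 1)) :
    (X i.castSucc ^ d - X (Fin.castSucc 0) ^ (d - (i : ℕ)) * X (Fin.last d).castSucc ^ (i : ℕ) :
      MvPolynomial (Fin (d + 1 + 1)) ℝ) ∈ curveIdeal d ε := by
  rw [mem_curveIdeal_iff]
  intro c θ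
  have h : c ^ d = c ^ (d - (i : ℕ)) * c ^ (i : ℕ) := by
    rw [← pow_add, Nat.sub_add_cancel (by omega)]
  simp only [map_sub, map_mul, map_pow, eval_X, Pi.smul_apply, smul_eq_mul, curvePoint_castSucc,
    Fin.val_zero, Fin.val_last, mul_pow, h, Nat.sub_zero, Nat.sub_self, pow_zero]
  ring

lemma ringKrullDim_curve_le (hd : 1 ≤ d) :
    ringKrullDim (MvPolynomial (Fin (d + 1 + 1)) ℝ ⧸ curveIdeal d ε) ≤ (2 : ℕ) := by
  let mk := Ideal.Quotient.mk (curveIdeal d ε)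
  let φ : MvPolynomial (Fin 2) ℝ →ₐ[ℝ] MvPolynomial (Fin (d + 1 + 1)) ℝ ⧸ curveIdeal d ε :=
    aeval ![mk (X (Fin.castSucc 0)), mk (X (Fin.last d).castSucc)]
  algebraize [φ.toRingHom]
  have hφ : ∀ g, IsIntegral (MvPolynomial (Fin 2) ℝ) (φ g) := fun g => isIntegral_algebraMap
  have hC : ∀ a : ℝ, IsIntegral (MvPolynomial (Fin 2) ℝ) (mk (C a)) := fun a => by
    have := hφ (C a)
    rwa [show φ (C a) = mk (C a) from algHom_C φ a] at this
  have hX : ∀ i : Fin (d + 1), IsIntegral (MvPolynomial (Fin 2) ℝ) (mk (X i.castSucc)) := by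
    intro i
    refine IsIntegral.of_pow (n := d) (by omega) ?_
    have h1 : mk (X i.castSucc) ^ d = φ (X 0 ^ (d - (i : ℕ)) * X 1 ^ (i : ℕ)) := by
      have := (Ideal.Quotient.eq_zero_iff_mem).mpr (X_pow_sub_mem_curveIdeal (ε := ε) i)
      rw [map_sub, sub_eq_zero] at this
      simpa [φ] using this
    rw [h1]
    exact hφ _
  have hlast : IsIntegral (MvPolynomial (Fin 2) ℝ) (mk (X (Fin.last (d + 1)))) := by
    refine IsIntegral.of_cubic
      (a := mk (C (3 / 4)) * ∑ j : Fin (d + 1), mk (C (d.choose j : ℝ)) * mk (X j.castSucc) ^ 2)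
      (b := mk (C (-ε / 4)) * mk (X (Fin.castSucc 0)) ^ 3) ?_ ?_ ?_
    · exact (hC _).mul (IsIntegral.sum _ fun j _ => (hC _).mul ((hX j).pow 2))
    · exact (hC _).mul ((hX 0).pow 3)
    · have h1 := (Ideal.Quotient.eq_zero_iff_mem).mpr
        ((curveIdeal d ε).mul_mem_left (C (1 / 4)) (curveCubic_mem_curveIdeal d ε))
      rw [← h1]
      simp only [← map_mul, ← map_pow, ← map_sum, ← map_add, mk]
      congr 1
      rw [curveCubic]
      have h4 : (C (1 / 4) : MvPolynomial (Fin (d + 1 + 1)) ℝ) * C 4 = 1 := by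
        rw [← C_mul]
        norm_num
      have h3 : (C (3 / 4) : MvPolynomial (Fin (d + 1 + 1)) ℝ) = C (1 / 4) * C 3 := by
        rw [← C_mul]
        norm_num
      have hε : (C (-ε / 4) : MvPolynomial (Fin (d + 1 + 1)) ℝ) = -(C (1 / 4) * C ε) := by
        rw [← C_mul, ← C_neg]
        ring_nf
      rw [h3, hε]
      linear_combination -(X (Fin.last (d + 1)) : MvPolynomial (Fin (d + 1 + 1)) ℝ) ^ 3 * h4
  have : Algebra.IsIntegral (MvPolynomial (Fin 2) ℝ)
      (MvPolynomial (Fin (d + 1 + 1)) ℝ ⧸ curveIdeal d ε) := by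
    refine ⟨fun q => ?_⟩
    obtain ⟨f, rfl⟩ := Ideal.Quotient.mk_surjective q
    induction f using MvPolynomial.induction_on with
    | C a => exact hC a
    | add p q hp hq =>
      rw [map_add]
      exact hp.add hq
    | mul_X p i hp =>
      rw [map_mul]
      refine hp.mul ?_
      induction i using Fin.lastCases with
      | last => exact hlast
      | cast i => exact hX i
  refine (ringKrullDim_le_of_isIntegral (MvPolynomial (Fin 2) ℝ) _).trans ?_
  rw [MvPolynomial.ringKrullDim_of_isNoetherianRing, ringKrullDim_eq_zero_of_field]
  simp

lemma le_ringKrullDim_curve (hd : 1 ≤ d) (hε : ε ≠ 0) :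
    (2 : ℕ) ≤ ringKrullDim (MvPolynomial (Fin (d + 1 + 1)) ℝ ⧸ curveIdeal d ε) := by
  rw [ringKrullDim_quotient]
  have h0 : curveIdeal d ε ≤ RingHom.ker (restrictLine (curvePoint d ε 0)) := fun f hf =>
    mem_curveIdeal_iff_restrictLine.mp hf 0
  have h1 : RingHom.ker (restrictLine (curvePoint d ε 0)) ≤
      RingHom.ker (eval (0 : Fin (d + 1 + 1) → ℝ)) := fun f hf => by
    rw [RingHom.mem_ker] at hf ⊢
    rw [← zero_smul ℝ (curvePoint d ε 0), ← eval_restrictLine, hf, Polynomial.eval_zero]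
  have h0' : ¬ RingHom.ker (restrictLine (curvePoint d ε 0)) ≤ curveIdeal d ε := fun h => by
    have hX : (X (Fin.castSucc ⟨1, by omega⟩) : MvPolynomial (Fin (d + 1 + 1)) ℝ) = 0 := by
      refine eq_zero_of_mem_curveIdeal_of_isHomogeneous_one hd hε (h ?_) (isHomogeneous_X _ _)
      rw [RingHom.mem_ker, restrictLine, aeval_X, curvePoint_zero]
      simp [Fin.ext_iff]
    exact X_ne_zero _ hX
  have h1' : ¬ RingHom.ker (eval (0 : Fin (d + 1 + 1) → ℝ)) ≤
      RingHom.ker (restrictLine (curvePoint d ε 0)) := fun h => by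
    have hX : (X (Fin.castSucc 0) : MvPolynomial (Fin (d + 1 + 1)) ℝ) ∈
        RingHom.ker (eval (0 : Fin (d + 1 + 1) → ℝ)) := by
      simp [RingHom.mem_ker]
    have := h hX
    rw [RingHom.mem_ker, restrictLine, aeval_X, curvePoint_zero] at this
    simp at this
  let p₀ : PrimeSpectrum.zeroLocus (curveIdeal d ε : Set (MvPolynomial (Fin (d + 1 + 1)) ℝ)) :=
    ⟨⟨_, curveIdeal_isPrime d ε⟩, le_refl (curveIdeal d ε)⟩
  let p₁ : PrimeSpectrum.zeroLocus (curveIdeal d ε : Set (MvPolynomial (Fin (d + 1 + 1)) ℝ)) :=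
    ⟨⟨_, RingHom.ker_isPrime (restrictLine (curvePoint d ε 0))⟩, h0⟩
  let p₂ : PrimeSpectrum.zeroLocus (curveIdeal d ε : Set (MvPolynomial (Fin (d + 1 + 1)) ℝ)) :=
    ⟨⟨_, RingHom.ker_isPrime (eval (0 : Fin (d + 1 + 1) → ℝ))⟩, h0.trans h1⟩
  have h01 : p₀ < p₁ := lt_of_le_not_ge h0 h0'
  have h12 : p₁ < p₂ := lt_of_le_not_ge h1 h1'
  rw [Order.le_krullDim_iff]
  refine ⟨⟨2, ![p₀, p₁, p₂], fun i => ?_⟩, rfl⟩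
  fin_cases i
  · exact h01
  · exact h12

end krullDim
section smoothPoint

lemma hasDerivAt_eval_mvPolynomial {σ : Type*} [Fintype σ] {x : ℝ → σ → ℝ} {x' : σ → ℝ} {t : ℝ}
    (h : ∀ i, HasDerivAt (fun τ => x τ i) (x' i) t) (f : MvPolynomial σ ℝ) :
    HasDerivAt (fun τ => eval (x τ) f) (∑ i, eval (x t) (pderiv i f) * x' i) t := by
  classical
  induction f using MvPolynomial.induction_on with
  | C a => simpa using hasDerivAt_const t a
  | add p q hp hq =>
    simp only [map_add, add_mul, Finset.sum_add_distrib]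
    exact hp.add hq
  | mul_X p j hp =>
    convert! hp.mul (h j) using 1
    · funext τ
      simp
    · have h1 : ∀ i, eval (x t) (pderiv i (p * X j)) * x' i =
          eval (x t) (pderiv i p) * x' i * x t j + eval (x t) p * (if j = i then x' i else 0) := by
        intro i
        simp only [Derivation.leibniz, smul_eq_mul, map_add, map_mul, eval_X, pderiv_X,
          Pi.single_apply]
        split_ifs <;> simp <;> ring
      simp only [h1, Finset.sum_add_distrib, ← Finset.sum_mul, ← Finset.mul_sum,
        Finset.sum_ite_eq, Finset.mem_univ, if_true]

variable {d : ℕ} {ε : ℝ}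

/-- The gradient at `x` of a polynomial. -/
noncomputable def gradientAt {σ : Type*} (x : σ → ℝ) (f : MvPolynomial σ ℝ) : σ → ℝ :=
  fun i => eval x (pderiv i f)

lemma curvePoint_zero_last (d : ℕ) (ε : ℝ) :
    curvePoint d ε 0 (Fin.last (d + 1)) = cubicRoot ε := by
  simp

lemma hasDerivAt_curvePoint_zero (hd : 1 ≤ d) (i : Fin (d + 1 + 1)) :
    HasDerivAt (fun θ => curvePoint d ε θ i)
      (if i = Fin.castSucc ⟨1, by omega⟩ then 1 else 0) 0 := by
  induction i using Fin.lastCases with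
  | last =>
    simp only [curvePoint_last]
    have h1 : HasDerivAt (fun θ => ε * Real.cos θ ^ (3 * d)) 0 0 := by
      simpa using ((Real.hasDerivAt_cos 0).pow (3 * d)).const_mul ε
    have h2 := (analyticAt_cubicRoot (ε * Real.cos 0 ^ (3 * d))).differentiableAt.hasDerivAt
    have h3 := h2.comp (0 : ℝ) h1
    rw [mul_zero] at h3
    rw [if_neg (by simp [Fin.ext_iff]; omega)]
    exact h3
  | cast i =>
    simp only [curvePoint_castSucc]
    convert! ((Real.hasDerivAt_cos 0).pow (d - (i : ℕ))).mul
      ((Real.hasDerivAt_sin 0).pow (i : ℕ)) using 1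
    rcases i with ⟨_ | _ | i, hi⟩ <;> simp [Fin.ext_iff]

lemma sum_eval_pderiv_mul_eq_zero {f : MvPolynomial (Fin (d + 1 + 1)) ℝ}
    (hf : f ∈ curveIdeal d ε) {x : ℝ → Fin (d + 1 + 1) → ℝ} {x' : Fin (d + 1 + 1) → ℝ} {t : ℝ}
    (hx : ∀ τ, x τ ∈ curveCone d ε) (h : ∀ i, HasDerivAt (fun τ => x τ i) (x' i) t) :
    ∑ i, eval (x t) (pderiv i f) * x' i = 0 := by
  have h1 := hasDerivAt_eval_mvPolynomial h f
  have h2 : (fun τ => eval (x τ) f) = fun _ => 0 := by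
    funext τ
    obtain ⟨c, θ, h⟩ := hx τ
    rw [h]
    exact mem_curveIdeal_iff.mp hf c θ
  rw [h2] at h1
  exact h1.unique (hasDerivAt_const t 0)

/-- The linear map whose kernel is the conormal space of the curve at `θ = 0`. -/
noncomputable def tangentPairing (hd : 1 ≤ d) (ε : ℝ) : (Fin (d + 1 + 1) → ℝ) →ₗ[ℝ] ℝ × ℝ :=
  (LinearMap.proj (Fin.castSucc ⟨1, by omega⟩)).prod
    (LinearMap.proj (Fin.castSucc 0) + cubicRoot ε • LinearMap.proj (Fin.last (d + 1)))

lemma tangentPairing_apply (hd : 1 ≤ d) (v : Fin (d + 1 + 1) → ℝ) :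
    tangentPairing hd ε v = (v (Fin.castSucc ⟨1, by omega⟩),
      v (Fin.castSucc 0) + cubicRoot ε * v (Fin.last (d + 1))) := rfl

lemma gradientAt_mem_ker (hd : 1 ≤ d) {f : MvPolynomial (Fin (d + 1 + 1)) ℝ}
    (hf : f ∈ curveIdeal d ε) :
    gradientAt (curvePoint d ε 0) f ∈ LinearMap.ker (tangentPairing hd ε) := by
  rw [LinearMap.mem_ker, tangentPairing_apply]
  have h1 := sum_eval_pderiv_mul_eq_zero hf (fun τ => ⟨1, τ, (one_smul _ _).symm⟩)
    (hasDerivAt_curvePoint_zero (ε := ε) hd)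
  have h2 := sum_eval_pderiv_mul_eq_zero hf (fun τ => ⟨τ, 0, rfl⟩)
    (x' := curvePoint d ε 0) (t := 1) (fun i => by
      simpa using (hasDerivAt_id (1 : ℝ)).mul_const (curvePoint d ε 0 i))
  rw [Fin.sum_univ_castSucc] at h2
  simp only [one_smul, curvePoint_zero, curvePoint_zero_last, mul_ite, mul_one, mul_zero,
    Finset.sum_ite_eq', Finset.mem_univ, if_true] at h1 h2
  rw [Prod.mk_eq_zero, mul_comm]
  exact ⟨h1, h2⟩

lemma gradientAt_quadric (i : ℕ) (hi : i + 1 < d + 1) (hi1 : 1 ≤ i) :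
    gradientAt (curvePoint d ε 0) (X (Fin.castSucc 0) * X (Fin.castSucc ⟨i + 1, hi⟩) -
      X (Fin.castSucc ⟨1, by omega⟩) * X (Fin.castSucc ⟨i, by omega⟩)) =
      Pi.single (Fin.castSucc ⟨i + 1, hi⟩) 1 := by
  funext k
  have h0 : curvePoint d ε 0 (Fin.castSucc ⟨i + 1, hi⟩) = 0 := by
    rw [curvePoint_zero]
    simp [Fin.ext_iff]
  have h1 : curvePoint d ε 0 (Fin.castSucc ⟨1, by omega⟩) = 0 := by
    rw [curvePoint_zero]
    simp [Fin.ext_iff]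
  have h2 : curvePoint d ε 0 (Fin.castSucc ⟨i, by omega⟩) = 0 := by
    rw [curvePoint_zero]
    simp [Fin.ext_iff]
    omega
  have h3 : curvePoint d ε 0 (Fin.castSucc 0) = 1 := by
    rw [curvePoint_zero]
    simp
  simp only [gradientAt, map_sub, Derivation.leibniz, smul_eq_mul, map_add, map_mul, eval_X,
    h0, h1, h2, h3, pderiv_X, Pi.single_apply, zero_mul, one_mul, add_zero, sub_zero]
  simp [apply_ite, eq_comm]

lemma gradientAt_curveCubic (d : ℕ) (ε : ℝ) :
    gradientAt (curvePoint d ε 0) (curveCubic d ε) =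
      (12 * cubicRoot ε ^ 2 + 3) • (Pi.single (Fin.last (d + 1)) 1 -
        cubicRoot ε • Pi.single (Fin.castSucc 0) 1) := by
  have h := cubicRoot_spec ε
  have h1 : ∑ j : Fin (d + 1), (d.choose j : ℝ) * curvePoint d ε 0 j.castSucc ^ 2 = 1 := by
    simpa using sum_choose_mul_sq d 0
  funext k
  have h2 : ∑ j : Fin (d + 1), (d.choose j : ℝ) * (2 * (curvePoint d ε 0 j.castSucc *
      (Pi.single k 1 : Fin (d + 1 + 1) → ℝ) j.castSucc)) =
      2 * (Pi.single k 1 : Fin (d + 1 + 1) → ℝ) (Fin.castSucc 0) := by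
    simp [curvePoint_zero, -curvePoint_castSucc]
  have h3 : ∀ i, eval (curvePoint d ε 0) ((Pi.single k 1 :
      Fin (d + 1 + 1) → MvPolynomial (Fin (d + 1 + 1)) ℝ) i) =
      (Pi.single k 1 : Fin (d + 1 + 1) → ℝ) i := by
    intro i
    simp only [Pi.single_apply]
    split_ifs <;> simp
  have h5 : ∀ i, (Pi.single i 1 : Fin (d + 1 + 1) → ℝ) k =
      (Pi.single k 1 : Fin (d + 1 + 1) → ℝ) i := by
    simp [Pi.single_apply, eq_comm]
  have h4 := curvePoint_zero d ε 0
  rw [if_pos rfl] at h4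
  simp only [gradientAt, curveCubic, map_sub, map_add, map_mul, map_sum, map_pow,
    Derivation.leibniz, Derivation.leibniz_pow, pderiv_C, pderiv_X, eval_X, eval_C, smul_eq_mul,
    nsmul_eq_mul, Nat.cast_ofNat, map_ofNat (eval (curvePoint d ε 0)), h1, h3, h5, mul_zero,
    add_zero,
    Nat.add_one_sub_one, pow_one, curvePoint_zero_last, h4, one_pow, h2, Pi.smul_apply,
    Pi.sub_apply]
  linear_combination 3 * (Pi.single k 1 : Fin (d + 1 + 1) → ℝ) (Fin.castSucc 0) * h

lemma span_gradientAt (hd : 1 ≤ d) :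
    Submodule.span ℝ (gradientAt (curvePoint d ε 0) '' curveIdeal d ε) =
      LinearMap.ker (tangentPairing hd ε) := by
  refine le_antisymm (Submodule.span_le.mpr ?_) fun v hv => ?_
  · rintro _ ⟨f, hf, rfl⟩
    exact gradientAt_mem_ker hd hf
  · have hρ : (Pi.single (Fin.last (d + 1)) 1 - cubicRoot ε • Pi.single (Fin.castSucc 0) 1 :
        Fin (d + 1 + 1) → ℝ) ∈
        Submodule.span ℝ (gradientAt (curvePoint d ε 0) '' curveIdeal d ε) := by
      have h1 : gradientAt (curvePoint d ε 0) (curveCubic d ε) ∈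
          Submodule.span ℝ (gradientAt (curvePoint d ε 0) '' curveIdeal d ε) :=
        Submodule.subset_span ⟨_, curveCubic_mem_curveIdeal d ε, rfl⟩
      rwa [gradientAt_curveCubic, Submodule.smul_mem_iff _ (by positivity)] at h1
    rw [LinearMap.mem_ker, tangentPairing_apply, Prod.mk_eq_zero] at hv
    have hw : v = v (Fin.last (d + 1)) • (Pi.single (Fin.last (d + 1)) 1 -
          cubicRoot ε • Pi.single (Fin.castSucc 0) 1) +
        ∑ i : Fin (d + 1), (if (i : ℕ) ≤ 1 then 0 else v i.castSucc) •
          Pi.single i.castSucc 1 := by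
      funext k
      simp only [Pi.add_apply, Finset.sum_apply, Pi.smul_apply, Pi.sub_apply, Pi.single_apply,
        smul_eq_mul, mul_ite, mul_one, mul_zero]
      induction k using Fin.lastCases with
      | last => simp [(Fin.castSucc_ne_last _).symm]
      | cast k =>
        simp only [Fin.castSucc_inj, Fin.castSucc_ne_last, Finset.sum_ite_eq, Finset.mem_univ,
          if_true, if_false]
        rcases k with ⟨_ | _ | k, hk⟩
        · simp at hv ⊢
          linarith [hv.2]
        · simp at hv ⊢
          exact hv.1
        · simp [Fin.ext_iff]
    rw [hw]
    refine add_mem (Submodule.smul_mem _ _ hρ) (Submodule.sum_mem _ fun i _ => ?_)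
    rcases i with ⟨_ | _ | i, hi⟩
    · simp
    · simp
    · refine Submodule.smul_mem _ _ (Submodule.subset_span ⟨_, ?_, gradientAt_quadric (i + 1) hi
        (by omega)⟩)
      exact quadric_mem_curveIdeal (by simp; omega)

lemma finrank_span_gradientAt (hd : 1 ≤ d) :
    Module.finrank ℝ (Submodule.span ℝ (gradientAt (curvePoint d ε 0) '' curveIdeal d ε)) = d := by
  have hsurj : Function.Surjective (tangentPairing hd ε) := fun ⟨a, b⟩ => by
    refine ⟨Pi.single (Fin.castSucc ⟨1, by omega⟩) a + Pi.single (Fin.castSucc 0) b, ?_⟩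
    rw [tangentPairing_apply]
    simp [Pi.single_apply, Fin.ext_iff]
    omega
  have h := LinearMap.finrank_range_add_finrank_ker (tangentPairing hd ε)
  rw [LinearMap.range_eq_top.mpr hsurj, finrank_top, Module.finrank_prod, Module.finrank_self,
    Module.finrank_fin_fun] at h
  rw [span_gradientAt hd]
  omega

end smoothPoint
section rank

lemma exists_sum_eq_mul_pow_mul_pow (a b : ℕ) : ∃ m : ℕ → ℂ, ∀ s t : ℂ,
    ∑ i ∈ Finset.range (a + b + 1), m i * (s ^ (a + b - i) * t ^ i) =
      (s + Complex.I * t) ^ a * (s - Complex.I * t) ^ b := by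
  have hstep : ∀ (k : ℕ) (w : ℂ) (F : ℂ → ℂ → ℂ),
      (∃ m : ℕ → ℂ, ∀ s t : ℂ, ∑ i ∈ Finset.range (k + 1), m i * (s ^ (k - i) * t ^ i) = F s t) →
      ∃ m : ℕ → ℂ, ∀ s t : ℂ, ∑ i ∈ Finset.range (k + 1 + 1), m i * (s ^ (k + 1 - i) * t ^ i) =
        F s t * (s + w * t) := by
    rintro k w F ⟨m, hm⟩
    refine ⟨fun i => (if i ≤ k then m i else 0) + if i = 0 then 0 else w * m (i - 1),
      fun s t => ?_⟩
    simp only [add_mul, Finset.sum_add_distrib]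
    rw [mul_add, ← hm]
    congr 1
    · rw [Finset.sum_range_succ, if_neg (by omega), zero_mul, add_zero, Finset.sum_mul]
      refine Finset.sum_congr rfl fun i hi => ?_
      have hi : i ≤ k := Nat.lt_succ_iff.mp (Finset.mem_range.mp hi)
      rw [if_pos hi, Nat.sub_add_comm hi, pow_succ]
      ring
    · rw [Finset.sum_range_succ', if_pos rfl, zero_mul, add_zero, Finset.sum_mul]
      refine Finset.sum_congr rfl fun i _ => ?_
      rw [if_neg (Nat.succ_ne_zero i), Nat.add_sub_add_right k, Nat.add_sub_cancel]
      ring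
  induction a with
  | zero =>
    induction b with
    | zero => exact ⟨fun _ => 1, by simp⟩
    | succ b ih =>
      obtain ⟨m, hm⟩ := hstep _ (-Complex.I) _ ih
      refine ⟨m, fun s t => ?_⟩
      rw [← add_assoc, hm]
      ring
  | succ a ih =>
    obtain ⟨m, hm⟩ := hstep _ Complex.I _ ih
    refine ⟨m, fun s t => ?_⟩
    rw [add_right_comm a 1 b, hm]
    ring

lemma exists_linearMap_curvePoint {d j : ℕ} (hj : j ≤ d) :
    ∃ M : (Fin (d + 1 + 1) → ℝ) →ₗ[ℝ] ℂ, M (Pi.single (Fin.last (d + 1)) 1) = 0 ∧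
      ∀ ε θ : ℝ, Complex.exp (θ * Complex.I) ^ d * M (curvePoint d ε θ) =
        Complex.exp (2 * θ * Complex.I) ^ j := by
  obtain ⟨m, hm⟩ := exists_sum_eq_mul_pow_mul_pow j (d - j)
  rw [Nat.add_sub_cancel' hj] at hm
  refine ⟨∑ i : Fin (d + 1), (LinearMap.proj i.castSucc).smulRight (m i), ?_, fun ε θ => ?_⟩
  · simp
  · have h1 : (∑ i : Fin (d + 1), (LinearMap.proj i.castSucc).smulRight (m i) :
        (Fin (d + 1 + 1) → ℝ) →ₗ[ℝ] ℂ) (curvePoint d ε θ) =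
        (Complex.cos θ + Complex.I * Complex.sin θ) ^ j *
          (Complex.cos θ - Complex.I * Complex.sin θ) ^ (d - j) := by
      rw [← hm, Finset.sum_range]
      simp [mul_comm]
    have h2 : Complex.cos θ + Complex.I * Complex.sin θ = Complex.exp (θ * Complex.I) := by
      rw [Complex.exp_mul_I, mul_comm]
    have h3 : Complex.cos θ - Complex.I * Complex.sin θ = Complex.exp (-(θ * Complex.I)) := by
      rw [← neg_mul, Complex.exp_mul_I, Complex.cos_neg, Complex.sin_neg]
      ring
    rw [h1, h2, h3, ← Complex.exp_nat_mul, ← Complex.exp_nat_mul, ← Complex.exp_nat_mul,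
      ← Complex.exp_nat_mul, ← Complex.exp_add, ← Complex.exp_add]
    congr 1
    push_cast [hj]
    ring

lemma exists_isOpen_forall_sum_ne (d : ℕ) : ∃ ε > (0 : ℝ), ∃ U : Set (Fin (d + 1 + 1) → ℝ),
    IsOpen U ∧ Pi.single (Fin.last (d + 1)) 1 ∈ U ∧ ∀ q ∈ U, ∀ r ≤ d + 1,
      ∀ x : Fin r → Fin (d + 1 + 1) → ℝ, (∀ i, x i ∈ curveCone d ε) → ∑ i, x i ≠ q := by
  obtain ⟨ε, hε, B, hB⟩ := exists_interpolation_bound d (d + 1)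
  have hM : ∀ j : ℕ, ∃ M : (Fin (d + 1 + 1) → ℝ) →ₗ[ℝ] ℂ,
      M (Pi.single (Fin.last (d + 1)) 1) = 0 ∧ (j ≤ d → ∀ ε θ : ℝ,
        Complex.exp (θ * Complex.I) ^ d * M (curvePoint d ε θ) =
          Complex.exp (2 * θ * Complex.I) ^ j) := by
    intro j
    by_cases hj : j ≤ d
    · obtain ⟨M, h1, h2⟩ := exists_linearMap_curvePoint hj
      exact ⟨M, h1, fun _ => h2⟩
    · exact ⟨0, rfl, fun h => absurd h hj⟩
  choose M hM0 hM using hM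
  refine ⟨ε, hε, {q | B * ∑ j ∈ Finset.range (d + 1), ‖M j q‖ < |q (Fin.last (d + 1))|},
    ?_, ?_, ?_⟩
  · refine isOpen_lt ?_ (by fun_prop)
    have := fun j => (M j).continuous_of_finiteDimensional
    fun_prop
  · simp [hM0]
  · rintro q hq r hr x hx rfl
    choose c θ hcθ using hx
    obtain ⟨b, hb, hbx⟩ := hB r θ hr
    have h1 : ∀ i, ((x i (Fin.last (d + 1)) : ℝ) : ℂ) =
        ∑ j ∈ Finset.range (d + 1), b j * M j (x i) := by
      intro i
      refine mul_left_cancel₀ (pow_ne_zero d (Complex.exp_ne_zero (θ i * Complex.I))) ?_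
      rw [Finset.mul_sum, hcθ i, Pi.smul_apply, curvePoint_last, smul_eq_mul, Complex.ofReal_mul,
        mul_left_comm, ← hbx i, Finset.mul_sum]
      refine Finset.sum_congr rfl fun j hj => ?_
      rw [← hM j (Nat.lt_succ_iff.mp (Finset.mem_range.mp hj)) ε, map_smul, Complex.real_smul]
      ring
    have h2 : (((∑ i, x i) (Fin.last (d + 1)) : ℝ) : ℂ) =
        ∑ j ∈ Finset.range (d + 1), b j * M j (∑ i, x i) := by
      simp only [Finset.sum_apply, Complex.ofReal_sum, h1, map_sum, Finset.mul_sum]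
      exact Finset.sum_comm
    rw [Set.mem_ofPred_eq] at hq
    refine absurd hq (not_lt.mpr ?_)
    rw [← Real.norm_eq_abs, ← Complex.norm_real, h2, Finset.mul_sum]
    refine (norm_sum_le _ _).trans (Finset.sum_le_sum fun j hj => ?_)
    rw [norm_mul]
    gcongr
    exact (Finset.single_le_sum (fun j _ => norm_nonneg (b j)) hj).trans hb

lemma exists_fin_sum_eq {d : ℕ} {ε : ℝ} (hd : 1 ≤ d) (hε : ε ≠ 0) (q : Fin (d + 1 + 1) → ℝ) :
    ∃ x : Fin (d + 1 + 1) → Fin (d + 1 + 1) → ℝ, (∀ i, x i ∈ curveCone d ε) ∧ ∑ i, x i = q := by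
  obtain ⟨f, hf, hspan, -⟩ := Submodule.exists_fun_fin_finrank_span_eq ℝ (curveCone d ε)
  have hq : q ∈ Submodule.span ℝ (Set.range f) := by
    rw [hspan, span_curveCone hd hε]
    trivial
  rw [Submodule.mem_span_range_iff_exists_fun] at hq
  obtain ⟨a, ha⟩ := hq
  have hn : Module.finrank ℝ (Submodule.span ℝ (curveCone d ε)) = d + 1 + 1 := by
    rw [span_curveCone hd hε, finrank_top, Module.finrank_fin_fun]
  refine ⟨fun i => a (Fin.cast hn.symm i) • f (Fin.cast hn.symm i), fun i => ?_, ?_⟩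
  · obtain ⟨c, θ, h⟩ := hf (Fin.cast hn.symm i)
    exact ⟨a (Fin.cast hn.symm i) * c, θ, by simp only [h, mul_smul]⟩
  · rw [← ha]
    exact (finCongr hn.symm).sum_comp fun i => a i • f i

lemma realRank_eq_of_forall_sum_ne {V : Type*} [AddCommMonoid V] {S : Set V} {q : V} {r : ℕ}
    (hr : ∃ x : Fin r → V, (∀ i, x i ∈ S) ∧ ∑ i, x i = q)
    (h : ∀ k < r, ∀ x : Fin k → V, (∀ i, x i ∈ S) → ∑ i, x i ≠ q) : realRank S q = r := by
  refine le_antisymm (sInf_le ⟨r, hr, rfl⟩) (le_sInf ?_)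
  rintro _ ⟨k, ⟨x, hx, hxq⟩, rfl⟩
  refine Nat.cast_le.mpr (not_lt.mp fun hk => h k hk x hx hxq)

end rank

/-- For every `n ≥ 2` there is a homogeneous prime ideal `I ⊆ ℝ[x₀,…,x_n]` containing no
nonzero linear form, defining an irreducible nondegenerate curve (Krull dimension of the
quotient is `2`) with a smooth real point, and a nonzero point `p` together with a Euclidean
open neighborhood `U` of `p` on which every point has real rank exactly `n + 1` with respect
to `V_ℝ(I)`:  the maximal real rank `codim + 2 = n + 1` is attained and typical. -/
theorem statement5 (n : ℕ) (hn : 2 ≤ n) :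
    ∃ I : Ideal (MvPolynomial (Fin (n + 1)) ℝ),
      (∀ f ∈ I, ∀ d : ℕ, (homogeneousComponent d f) ∈ I) ∧
      I.IsPrime ∧
      (∀ f ∈ I, f ∈ homogeneousSubmodule (Fin (n + 1)) ℝ 1 → f = 0) ∧
      ringKrullDim (MvPolynomial (Fin (n + 1)) ℝ ⧸ I) = (2 : ℕ) ∧
      (∃ x : Fin (n + 1) → ℝ, x ≠ 0 ∧ x ∈ realVariety I ∧
        Module.finrank ℝ (Submodule.span ℝ
          {g : Fin (n + 1) → ℝ | ∃ f ∈ I, g = fun i => eval x (pderiv i f)}) = n - 1) ∧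
      ∃ p : Fin (n + 1) → ℝ, p ≠ 0 ∧
        ∃ U : Set (Fin (n + 1) → ℝ), IsOpen U ∧ p ∈ U ∧
          ∀ q ∈ U, realRank (realVariety I) q = (n + 1 : ℕ) := by
  obtain ⟨d, rfl⟩ : ∃ d, n = d + 1 := ⟨n - 1, by omega⟩
  have hd : 1 ≤ d := by omega
  obtain ⟨ε, hε, U, hU, hpU, hrank⟩ := exists_isOpen_forall_sum_ne d
  refine ⟨curveIdeal d ε, fun f hf k => homogeneousComponent_mem_curveIdeal hf k,
    curveIdeal_isPrime d ε,
    fun f hf hf1 => eq_zero_of_mem_curveIdeal_of_isHomogeneous_one hd hε.ne' hf hf1,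
    le_antisymm (ringKrullDim_curve_le hd) (le_ringKrullDim_curve hd hε.ne'),
    ⟨curvePoint d ε 0, fun h => ?_, ?_, ?_⟩, Pi.single (Fin.last (d + 1)) 1, by simp, U, hU, hpU,
    fun q hq => ?_⟩
  · have := congrFun h (Fin.castSucc 0)
    rw [curvePoint_zero] at this
    simp at this
  · rw [realVariety_curveIdeal hd]
    exact ⟨1, 0, (one_smul _ _).symm⟩
  · have hset : {g : Fin (d + 1 + 1) → ℝ | ∃ f ∈ curveIdeal d ε,
        g = fun i => eval (curvePoint d ε 0) (pderiv i f)} =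
        gradientAt (curvePoint d ε 0) '' curveIdeal d ε := by
      ext g
      exact ⟨fun ⟨f, hf, h⟩ => ⟨f, hf, h.symm⟩, fun ⟨f, hf, h⟩ => ⟨f, hf, h.symm⟩⟩
    rw [hset, finrank_span_gradientAt hd, Nat.add_sub_cancel]
  · rw [realVariety_curveIdeal hd]
    exact realRank_eq_of_forall_sum_ne (exists_fin_sum_eq hd hε.ne' q) fun k hk =>
      hrank q hq k (Nat.lt_succ_iff.mp hk)
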